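/- arXiv:1308.2653 — 8 statements merged into one kernel-verified Lean document; each statement's English description precedes it below -/
import Mathlib

section
/- For all σ, ρ ∈ S(n) the following composition rules hold: (i) if σ(n) = n and ρ(n) = n, then V(σ)^{t_n} · V(ρ)^{t_n} = V(σ) · V(ρ) = V(σρ); (ii) if σ(n) = n, then V(σ) · V(ρ)^{t_n} = V(σρ)^{t_n}; (iii) if ρ(n) = n, then V(σ)^{t_n} · V(ρ) = V(σρ)^{t_n}; (iv) if σ(n) = b ≠ n with σ(a) = n and ρ(n) = q ≠ n with ρ(p) = n (so a,b,p,q ∈ {1,…,n−1}), then V(σ)^{t_n} · V(ρ)^{t_n} = d^{δ_{aq}} · V((σ(q) n) · σ · ρ · (p n))^{t_n}, where (σ(q) n) denotes the transposition of σ(q) and n, understood as the identity when σ(q) = n (i.e. when q = a). -/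
/-- The permutation operator `V(σ)` on `(ℂ^d)^{⊗ n}`, realized as the square matrix
indexed by functions `f g : Fin n → Fin d`, with entry `1` if `g = f ∘ σ` and `0` otherwise. -/
noncomputable def V (n d : ℕ) (σ : Equiv.Perm (Fin n)) :
    Matrix (Fin n → Fin d) (Fin n → Fin d) ℂ :=
  Matrix.of fun f g => if g = f ∘ σ then 1 else 0

/-- Partial transpose of a matrix on `(ℂ^d)^{⊗ n}` at position `p`. -/
noncomputable def pt {n d : ℕ} (p : Fin n)
    (A : Matrix (Fin n → Fin d) (Fin n → Fin d) ℂ) :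
    Matrix (Fin n → Fin d) (Fin n → Fin d) ℂ :=
  Matrix.of fun f g =>
    A (Function.update f p (g p)) (Function.update g p (f p))

/-- The last position `n` of the tensor product, as an element of `Fin n`. -/
def lastIdx (n : ℕ) (hn : 1 ≤ n) : Fin n := ⟨n - 1, by omega⟩

section PartialTranspose

open Equiv Function

variable {n d : ℕ}

theorem V_mul_apply (σ : Perm (Fin n)) (M : Matrix (Fin n → Fin d) (Fin n → Fin d) ℂ)
    (f h : Fin n → Fin d) : (V n d σ * M) f h = M (f ∘ σ) h := by
  simp [Matrix.mul_apply, V]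

theorem mul_V_apply (ρ : Perm (Fin n)) (M : Matrix (Fin n → Fin d) (Fin n → Fin d) ℂ)
    (f h : Fin n → Fin d) : (M * V n d ρ) f h = M f (h ∘ ρ.symm) := by
  have key (g : Fin n → Fin d) : h = g ∘ ρ ↔ h ∘ ρ.symm = g := (Equiv.comp_symm_eq ρ g h).symm
  simp [Matrix.mul_apply, V, key]

theorem V_mul_V (σ ρ : Perm (Fin n)) : V n d σ * V n d ρ = V n d (σ * ρ) := by
  ext f h
  rw [V_mul_apply]
  rfl

theorem update_comp_perm_of_fixed {N : Fin n} {σ : Perm (Fin n)} (hσ : σ N = N)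
    (f : Fin n → Fin d) (x : Fin d) : update (f ∘ σ) N x = update f N x ∘ σ := by
  rw [← update_comp_eq_of_injective f σ.injective N x, hσ]

theorem V_mul_pt {N : Fin n} {σ : Perm (Fin n)} (hσ : σ N = N) (ρ : Perm (Fin n)) :
    V n d σ * pt N (V n d ρ) = pt N (V n d (σ * ρ)) := by
  ext f h
  rw [V_mul_apply]
  simp only [pt, V, Matrix.of_apply, update_comp_perm_of_fixed hσ, comp_apply, hσ]
  rfl

theorem pt_mul_V {N : Fin n} (σ : Perm (Fin n)) {ρ : Perm (Fin n)} (hρ : ρ N = N) :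
    pt N (V n d σ) * V n d ρ = pt N (V n d (σ * ρ)) := by
  ext f h
  have hρ' : ρ.symm N = N := by rw [Equiv.symm_apply_eq, hρ]
  rw [mul_V_apply]
  simp only [pt, V, Matrix.of_apply, update_comp_perm_of_fixed hρ', comp_apply, hρ',
    Equiv.comp_symm_eq]
  rfl

theorem pt_V_of_fixed {N : Fin n} {σ : Perm (Fin n)} (hσ : σ N = N) :
    pt N (V n d σ) = V n d σ := by
  ext f g
  simp only [pt, V, Matrix.of_apply]
  congr 1
  rw [← update_comp_perm_of_fixed hσ, eq_iff_iff, funext_iff, funext_iff]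
  refine forall_congr' fun i => ?_
  rcases eq_or_ne i N with rfl | hi
  · simp [hσ, eq_comm]
  · simp [hi]

theorem pt_V_apply {N a b : Fin n} {σ : Perm (Fin n)} (hb : σ N = b) (hbN : b ≠ N)
    (ha : σ a = N) (f g : Fin n → Fin d) :
    pt N (V n d σ) f g =
      if f N = f b ∧ g a = g N ∧ ∀ i, i ≠ a → i ≠ N → g i = f (σ i) then 1 else 0 := by
  have haN : a ≠ N := by rintro rfl; exact hbN (hb ▸ ha)
  simp only [pt, V, Matrix.of_apply]
  congr 1
  rw [eq_iff_iff, funext_iff]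
  constructor
  · intro H
    refine ⟨?_, ?_, fun i hi hiN => ?_⟩
    · simpa [hb, hbN] using H N
    · simpa [ha, haN] using H a
    · have hσi : σ i ≠ N := fun h => hi (σ.injective (h.trans ha.symm))
      simpa [hiN, hσi] using H i
  · rintro ⟨h1, h2, h3⟩ i
    rcases eq_or_ne i N with rfl | hiN
    · simpa [hb, hbN] using h1
    rcases eq_or_ne i a with rfl | hia
    · simpa [ha, haN] using h2
    have hσi : σ i ≠ N := fun h => hia (σ.injective (h.trans ha.symm))
    simpa [hiN, hσi] using h3 i hia hiN

theorem pt_V_mul_pt_V_apply {N a b p q : Fin n} {σ ρ : Perm (Fin n)}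
    (hb : σ N = b) (hbN : b ≠ N) (ha : σ a = N) (hq : ρ N = q) (hqN : q ≠ N) (hp : ρ p = N)
    (f h : Fin n → Fin d) :
    (pt N (V n d σ) * pt N (V n d ρ)) f h =
      (d : ℂ) ^ (if a = q then 1 else 0 : ℕ) *
        if f N = f b ∧ h p = h N ∧
          ∀ i, i ≠ p → i ≠ N → h i = f (swap (σ q) N (σ (ρ i))) then 1 else 0 := by
  have haN : a ≠ N := by rintro rfl; exact hbN (hb ▸ ha)
  let φ : Fin d → Fin n → Fin d := fun x i => if i = a ∨ i = N then x else f (σ i)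
  have hφ : Injective φ := fun x y hxy => by simpa [φ] using congrFun hxy N
  have hρN (i) (hi : i ≠ p) : ρ i ≠ N := fun e => hi (ρ.injective (e.trans hp.symm))
  have hρq (i) (hi : i ≠ N) : ρ i ≠ q := fun e => hi (ρ.injective (e.trans hq.symm))
  have hσb (i) (hi : i ≠ a) : σ i ≠ N := fun e => hi (σ.injective (e.trans ha.symm))
  have hσq (i) (hi : i ≠ q) : σ i ≠ σ q := fun e => hi (σ.injective e)
  rw [Matrix.mul_apply]
  simp only [pt_V_apply hb hbN ha, pt_V_apply hq hqN hp]
  simp only [← ite_and, mul_ite, mul_one, mul_zero]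
  let R := f N = f b ∧ h p = h N ∧
    ∀ i, i ≠ p → i ≠ N → h i = f (swap (σ q) N (σ (ρ i)))
  have mid (g : Fin n → Fin d) :
      ((g N = g q ∧ h p = h N ∧ ∀ i, i ≠ p → i ≠ N → h i = g (ρ i)) ∧
        f N = f b ∧ g a = g N ∧ ∀ i, i ≠ a → i ≠ N → g i = f (σ i)) ↔
      R ∧ ∃ x, (a = q ∨ x = f (σ q)) ∧ φ x = g := by
    have transfer (x) (hx : a = q ∨ x = f (σ q)) (i) (hip : i ≠ p) (hiN : i ≠ N) :
        φ x (ρ i) = f (swap (σ q) N (σ (ρ i))) := by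
      rcases eq_or_ne (ρ i) a with hia | hia
      · have hx' : x = f (σ q) := hx.resolve_left fun e => hρq i hiN (hia.trans e)
        simp [φ, hia, ha, hx']
      · rw [swap_apply_of_ne_of_ne (hσq _ (hρq i hiN)) (hσb _ hia)]
        simp [φ, hia, hρN i hip]
    constructor
    · rintro ⟨⟨h1, h2, h3⟩, h4, h5, h6⟩
      have hx : a = q ∨ g N = f (σ q) := by
        rcases eq_or_ne a q with e | e
        · exact Or.inl e
        · exact Or.inr (h1.trans (h6 q e.symm hqN))
      have hg : φ (g N) = g := by
        funext i
        by_cases hi : i = a ∨ i = N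
        · rcases hi with rfl | rfl <;> simp [φ, h5]
        · push Not at hi
          simp [φ, hi.1, hi.2, h6 i hi.1 hi.2]
      refine ⟨⟨h4, h2, fun i hip hiN => ?_⟩, g N, hx, hg⟩
      rw [h3 i hip hiN, ← transfer _ hx i hip hiN, hg]
    · rintro ⟨⟨h1, h2, h3⟩, x, hx, rfl⟩
      refine ⟨⟨?_, h2, fun i hip hiN => ?_⟩, h1, by simp [φ], fun i hia hiN => by
        simp [φ, hia, hiN]⟩
      · rcases eq_or_ne a q with e | e
        · simp [φ, e]
        · simp [φ, hx.resolve_left e]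
      · rw [h3 i hip hiN, transfer _ hx i hip hiN]
  simp only [mid]
  by_cases hRt : R
  · rw [if_pos hRt]
    simp only [hRt, true_and]
    rw [Finset.sum_boole]
    have himage : (Finset.univ.filter fun g => ∃ x, (a = q ∨ x = f (σ q)) ∧ φ x = g) =
        (Finset.univ.filter fun x => a = q ∨ x = f (σ q)).image φ := by
      ext g
      simp
    rw [himage, Finset.card_image_of_injective _ hφ]
    by_cases e : a = q
    · simp [e]
    · simp [e, Finset.filter_eq']
  · rw [if_neg hRt]
    simp [hRt]

theorem pt_V_mul_pt_V {N a b p q : Fin n} {σ ρ : Perm (Fin n)}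
    (hb : σ N = b) (hbN : b ≠ N) (ha : σ a = N) (hq : ρ N = q) (hqN : q ≠ N) (hp : ρ p = N) :
    pt N (V n d σ) * pt N (V n d ρ) =
      ((d : ℂ) ^ (if a = q then 1 else 0 : ℕ)) •
        pt N (V n d (swap (σ q) N * σ * ρ * swap p N)) := by
  ext f h
  have hτN : (swap (σ q) N * σ * ρ * swap p N) N = b := by
    have hbq : b ≠ σ q := fun e => hqN (σ.injective (e.symm.trans hb.symm))
    simp [hp, hb, swap_apply_of_ne_of_ne hbq hbN]
  have hτp : (swap (σ q) N * σ * ρ * swap p N) p = N := by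
    simp [hq]
  rw [pt_V_mul_pt_V_apply hb hbN ha hq hqN hp, Matrix.smul_apply, pt_V_apply hτN hbN hτp,
    smul_eq_mul]
  congr 2
  simp +contextual [swap_apply_of_ne_of_ne]

end PartialTranspose

/-- Composition rules for the natural generators `V(σ)^{t_n}` of `A_n^{t_n}(d)`. -/
theorem composition_rules (n d : ℕ) (hn : 1 ≤ n) (hd : 1 ≤ d) :
    (∀ σ ρ : Equiv.Perm (Fin n),
        σ (lastIdx n hn) = lastIdx n hn → ρ (lastIdx n hn) = lastIdx n hn →
        pt (lastIdx n hn) (V n d σ) * pt (lastIdx n hn) (V n d ρ) = V n d σ * V n d ρ ∧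
        V n d σ * V n d ρ = V n d (σ * ρ)) ∧
    (∀ σ ρ : Equiv.Perm (Fin n), σ (lastIdx n hn) = lastIdx n hn →
        V n d σ * pt (lastIdx n hn) (V n d ρ) = pt (lastIdx n hn) (V n d (σ * ρ))) ∧
    (∀ σ ρ : Equiv.Perm (Fin n), ρ (lastIdx n hn) = lastIdx n hn →
        pt (lastIdx n hn) (V n d σ) * V n d ρ = pt (lastIdx n hn) (V n d (σ * ρ))) ∧
    (∀ σ ρ : Equiv.Perm (Fin n), ∀ a b p q : Fin n,
        σ (lastIdx n hn) = b → b ≠ lastIdx n hn → σ a = lastIdx n hn →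
        ρ (lastIdx n hn) = q → q ≠ lastIdx n hn → ρ p = lastIdx n hn →
        pt (lastIdx n hn) (V n d σ) * pt (lastIdx n hn) (V n d ρ) =
          ((d : ℂ) ^ (if a = q then 1 else 0 : ℕ)) •
            pt (lastIdx n hn)
              (V n d (Equiv.swap (σ q) (lastIdx n hn) * σ * ρ *
                Equiv.swap p (lastIdx n hn)))) := by
  refine ⟨fun σ ρ hσ hρ => ⟨?_, V_mul_V σ ρ⟩, fun σ ρ hσ => V_mul_pt hσ ρ,
    fun σ ρ hρ => pt_mul_V σ hρ, fun σ ρ a b p q hb hbN ha hq hqN hp =>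
      pt_V_mul_pt_V hb hbN ha hq hqN hp⟩
  rw [pt_V_of_fixed hσ, pt_V_of_fixed hρ]
end

section
/- The family of matrices (V(σ))_{σ ∈ S(n)} is linearly independent over ℂ if and only if d ≥ n. -/
theorem V_apply (n d : ℕ) (σ : Equiv.Perm (Fin n)) (f g : Fin n → Fin d) :
    V n d σ f g = if g = f ∘ σ then 1 else 0 := rfl

/-- For `d ≥ n` an injective row index `f` separates the permutation operators. -/
theorem V_linearIndependent_of_le {n d : ℕ} (h : n ≤ d) :
    LinearIndependent ℂ (fun σ : Equiv.Perm (Fin n) => V n d σ) := by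
  rw [Fintype.linearIndependent_iff]
  intro c hc τ
  have hf : Function.Injective (Fin.castLE h) := Fin.castLE_injective h
  have key := congrFun (congrFun hc (Fin.castLE h)) (Fin.castLE h ∘ τ)
  simpa [Matrix.sum_apply, V_apply, hf.comp_left.eq_iff] using key

/-- The entries of the antisymmetrizer are determinants of 0-1 matrices. -/
theorem sum_sign_smul_V_apply (n d : ℕ) (f g : Fin n → Fin d) :
    (∑ σ : Equiv.Perm (Fin n), ((Equiv.Perm.sign σ : ℤ) : ℂ) • V n d σ) f g =
      (Matrix.of fun i j => if g j = f i then (1 : ℂ) else 0).det := by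
  simp [Matrix.det_apply', Matrix.sum_apply, V_apply, Finset.prod_ite_zero, funext_iff]

/-- For `d < n` the antisymmetrizer vanishes. -/
theorem sum_sign_smul_V_eq_zero {n d : ℕ} (h : d < n) :
    ∑ σ : Equiv.Perm (Fin n), ((Equiv.Perm.sign σ : ℤ) : ℂ) • V n d σ = 0 := by
  ext f g
  obtain ⟨a, b, hab, hfab⟩ := Fintype.exists_ne_map_eq_of_card_lt f (by simpa using h)
  rw [sum_sign_smul_V_apply]
  exact Matrix.det_zero_of_row_eq hab (by ext j; simp [hfab])

/-- The family `(V(σ))_{σ ∈ S(n)}` is linearly independent over `ℂ` iff `d ≥ n`. -/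
theorem V_linearIndependent_iff (n d : ℕ) (hn : 1 ≤ n) (hd : 1 ≤ d) :
    LinearIndependent ℂ (fun σ : Equiv.Perm (Fin n) => V n d σ) ↔ n ≤ d := by
  refine ⟨fun h => ?_, V_linearIndependent_of_le⟩
  by_contra! hlt
  simpa using Fintype.linearIndependent_iff.mp h _ (sum_sign_smul_V_eq_zero hlt) 1
end

section
/- For all integers n ≥ 1 and d ≥ 1, the algebra A_n^{t_n}(d) is a semisimple ring. -/
open Matrix ComplexOrder in
/-- A Hermitian matrix over `ℂ` that is nilpotent vanishes. -/
theorem Matrix.IsHermitian.eq_zero_of_isNilpotent {m : Type*} [Fintype m] [DecidableEq m]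
    {H : Matrix m m ℂ} (hH : H.IsHermitian) (hnil : IsNilpotent H) : H = 0 := by
  have key : ∀ k : ℕ, H ^ 2 ^ k = 0 → H = 0 := by
    intro k
    induction k with
    | zero => simp
    | succ k ih =>
      intro h
      apply ih
      rw [← conjTranspose_mul_self_eq_zero, (hH.pow (2 ^ k)).eq, ← pow_add, ← two_mul,
        ← pow_succ', h]
  obtain ⟨k, hk⟩ := hnil
  exact key k (pow_eq_zero_of_le Nat.lt_two_pow_self.le hk)

open Matrix ComplexOrder in
/-- A subalgebra of a complex matrix algebra closed under conjugate transposition is semisimple. -/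
theorem Subalgebra.isSemisimpleRing_of_conjTranspose_mem {m : Type*} [Fintype m] [DecidableEq m]
    (S : Subalgebra ℂ (Matrix m m ℂ)) (hS : ∀ A ∈ S, Aᴴ ∈ S) : IsSemisimpleRing S := by
  have : IsArtinianRing S := IsArtinianRing.of_finite ℂ S
  rw [IsArtinianRing.isSemisimpleRing_iff_jacobson, eq_bot_iff]
  intro a ha
  obtain ⟨k, hk⟩ := IsSemiprimaryRing.isNilpotent (R := S)
  have hmem : (⟨(a : Matrix m m ℂ)ᴴ, hS _ a.2⟩ : S) * a ∈ Ring.jacobson S :=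
    Ideal.mul_mem_left _ _ ha
  have hpow := Ideal.pow_mem_pow hmem k
  rw [hk] at hpow
  have hnil : IsNilpotent ((a : Matrix m m ℂ)ᴴ * a) :=
    ⟨k, by simpa using congrArg Subtype.val (Ideal.mem_bot.mp hpow)⟩
  have hzero := (isHermitian_conjTranspose_mul_self (a : Matrix m m ℂ)).eq_zero_of_isNilpotent hnil
  exact Subtype.ext (conjTranspose_mul_self_eq_zero.mp hzero)

open Matrix in
/-- The algebra generated by a set of matrices closed under conjugate transposition is closed
under conjugate transposition. -/
theorem Algebra.conjTranspose_mem_adjoin {m : Type*} [Fintype m] [DecidableEq m]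
    {s : Set (Matrix m m ℂ)} (hs : ∀ A ∈ s, Aᴴ ∈ s) {A : Matrix m m ℂ}
    (hA : A ∈ Algebra.adjoin ℂ s) : Aᴴ ∈ Algebra.adjoin ℂ s := by
  induction hA using Algebra.adjoin_induction with
  | mem A hA => exact Algebra.subset_adjoin (hs A hA)
  | algebraMap c =>
    rw [Algebra.algebraMap_eq_smul_one, conjTranspose_smul, conjTranspose_one]
    exact Subalgebra.smul_mem _ (one_mem _) _
  | add A B _ _ hA hB => rw [conjTranspose_add]; exact add_mem hA hB
  | mul A B _ _ hA hB => rw [conjTranspose_mul]; exact mul_mem hB hA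

open Matrix in
theorem V_conjTranspose (n d : ℕ) (σ : Equiv.Perm (Fin n)) : (V n d σ)ᴴ = V n d σ⁻¹ := by
  ext f g
  have h : f = g ∘ σ ↔ g = f ∘ ⇑σ⁻¹ := by
    rw [← Equiv.comp_symm_eq, eq_comm]; rfl
  simp only [V, conjTranspose_apply, of_apply, h]
  split_ifs <;> simp

open Matrix in
theorem pt_conjTranspose {n d : ℕ} (p : Fin n) (A : Matrix (Fin n → Fin d) (Fin n → Fin d) ℂ) :
    (pt p A)ᴴ = pt p Aᴴ := rfl

/-- The algebra `A_n^{t_n}(d)`, the unital subalgebra of the matrix algebra generated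
(equivalently, spanned) by the partially transposed permutation operators `V(σ)^{t_n}`,
is a semisimple ring, for all `n ≥ 1` and `d ≥ 1`. -/
theorem A_pt_isSemisimpleRing (n d : ℕ) (hn : 1 ≤ n) (hd : 1 ≤ d) :
    IsSemisimpleRing
      (Algebra.adjoin ℂ
        (Set.range fun σ : Equiv.Perm (Fin n) => pt (lastIdx n hn) (V n d σ))) := by
  refine Subalgebra.isSemisimpleRing_of_conjTranspose_mem _
    fun A hA => Algebra.conjTranspose_mem_adjoin ?_ hA
  rintro _ ⟨σ, rfl⟩
  exact ⟨σ⁻¹, by simp only [pt_conjTranspose, V_conjTranspose]⟩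
end

section
/- Assume d ≥ 2. Then there exists a ℂ-algebra homomorphism Ψ : A_n^{t_n}(d) → ℂ (ℂ-linear, multiplicative, sending the identity to 1) such that Ψ(V(σ)^{t_n}) = 0 for every σ ∈ S(n) with σ(n) ≠ n, and Ψ(V(σ)) = 1 for every σ ∈ S(n) with σ(n) = n (the trivial, one-dimensional representation of the algebra A_n^{t_n}(d)). -/
/-- The algebra `A_n^{t_n}(d)` as a unital subalgebra of the matrix algebra,
generated by the partially transposed permutation operators. -/
noncomputable def Aalg (n d : ℕ) (hn : 1 ≤ n) :
    Subalgebra ℂ (Matrix (Fin n → Fin d) (Fin n → Fin d) ℂ) :=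
  Algebra.adjoin ℂ (Set.range fun σ : Equiv.Perm (Fin n) => pt (lastIdx n hn) (V n d σ))

/-- The diagonal entry `(i, i)`, as an algebra homomorphism on a subalgebra of matrices whose
`i`-th rows vanish off the diagonal. -/
def diagEntryAlgHom {R ι : Type*} [CommSemiring R] [Fintype ι] [DecidableEq ι]
    (S : Subalgebra R (Matrix ι ι R)) (i : ι) (hS : ∀ A ∈ S, ∀ j, j ≠ i → A i j = 0) :
    S →ₐ[R] R where
  toFun A := A.1 i i
  map_one' := by simp
  map_mul' A B := by
    change (A.1 * B.1) i i = _
    rw [Matrix.mul_apply, Finset.sum_eq_single i (fun j _ hj => by rw [hS A.1 A.2 j hj, zero_mul])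
      (by simp)]
  map_zero' := rfl
  map_add' _ _ := rfl
  commutes' r := by simp [Matrix.algebraMap_eq_diagonal]

/-- If the `i`-th rows of all generators vanish off the diagonal, the same holds for the
generated subalgebra. -/
theorem row_eq_zero_of_mem_adjoin {R ι : Type*} [CommSemiring R] [Fintype ι] [DecidableEq ι]
    {s : Set (Matrix ι ι R)} {i : ι} (hs : ∀ A ∈ s, ∀ j, j ≠ i → A i j = 0) :
    ∀ A ∈ Algebra.adjoin R s, ∀ j, j ≠ i → A i j = 0 := by
  intro A hA
  induction hA using Algebra.adjoin_induction with
  | mem A hA => exact hs A hA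
  | algebraMap r =>
    intro j hj
    simp [Matrix.algebraMap_eq_diagonal, Matrix.diagonal_apply_ne' _ hj]
  | add A B _ _ hA hB =>
    intro j hj
    simp [hA j hj, hB j hj]
  | mul A B _ _ hA hB =>
    intro j hj
    rw [Matrix.mul_apply]
    refine Finset.sum_eq_zero fun k _ => ?_
    by_cases hk : k = i
    · rw [hk, hB j hj, mul_zero]
    · rw [hA k hk, zero_mul]

/-- If `σ` moves `p`, the row of the partial transpose of `V(σ)` at `p` indexed by the function
taking the value `b` at `p` and `a ≠ b` elsewhere vanishes. -/
theorem pt_V_update_const_of_ne {n d : ℕ} {p : Fin n} {a b : Fin d} (hab : a ≠ b)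
    {σ : Equiv.Perm (Fin n)} (hσ : σ p ≠ p) (g : Fin n → Fin d) :
    pt p (V n d σ) (Function.update (fun _ => a) p b) g = 0 := by
  simp only [pt, V, Matrix.of_apply, ite_eq_right_iff]
  intro h
  have := congrFun h p
  simp [Function.update_of_ne hσ, hab.symm] at this

/-- The row of the partial transpose of `V(σ)` at `p` indexed by the function taking the value `b`
at `p` and `a ≠ b` elsewhere vanishes off the diagonal. -/
theorem pt_V_update_const_off_diag {n d : ℕ} {p : Fin n} {a b : Fin d} (hab : a ≠ b)
    (σ : Equiv.Perm (Fin n)) (g : Fin n → Fin d) (hg : g ≠ Function.update (fun _ => a) p b) :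
    pt p (V n d σ) (Function.update (fun _ => a) p b) g = 0 := by
  by_cases hσ : σ p = p
  · simp only [pt, V, Matrix.of_apply, ite_eq_right_iff]
    intro h
    refine absurd (funext fun i => ?_) hg
    have hi := congrFun h i
    by_cases hip : i = p
    · subst hip
      simpa [hσ, eq_comm] using hi
    · have hσi : σ i ≠ p := fun h' => hip (σ.injective (h'.trans hσ.symm))
      simpa [hip, hσi] using hi
  · exact pt_V_update_const_of_ne hab hσ g

/-- If `σ` fixes `p`, then `V(σ)` has diagonal entry `1` at any function constant off `p`. -/
theorem V_update_const_self {n d : ℕ} {p : Fin n} (a b : Fin d)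
    {σ : Equiv.Perm (Fin n)} (hσ : σ p = p) :
    V n d σ (Function.update (fun _ => a) p b) (Function.update (fun _ => a) p b) = 1 := by
  simp only [V, Matrix.of_apply, ite_eq_left_iff]
  refine fun h => absurd (funext fun i => ?_) h
  have : σ i = p ↔ i = p := by
    rw [← σ.injective.eq_iff (a := i) (b := p), hσ]
  simp [Function.update_apply, this]

/-- For `d ≥ 2` the algebra `A_n^{t_n}(d)` has the trivial one-dimensional representation:
a `ℂ`-algebra homomorphism `Ψ : A_n^{t_n}(d) → ℂ` vanishing on the generators
`V(σ)^{t_n}` with `σ(n) ≠ n` and equal to `1` on the `V(σ)` with `σ(n) = n`. -/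
theorem exists_trivial_representation (n d : ℕ) (hn : 1 ≤ n) (hd : 2 ≤ d) :
    ∃ Ψ : Aalg n d hn →ₐ[ℂ] ℂ,
      (∀ σ : Equiv.Perm (Fin n), σ (lastIdx n hn) ≠ lastIdx n hn →
        ∀ h : pt (lastIdx n hn) (V n d σ) ∈ Aalg n d hn,
          Ψ ⟨pt (lastIdx n hn) (V n d σ), h⟩ = 0) ∧
      (∀ σ : Equiv.Perm (Fin n), σ (lastIdx n hn) = lastIdx n hn →
        ∀ h : V n d σ ∈ Aalg n d hn,
          Ψ ⟨V n d σ, h⟩ = 1) := by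
  have hab : (⟨0, by omega⟩ : Fin d) ≠ ⟨1, by omega⟩ := by simp
  refine ⟨diagEntryAlgHom (Aalg n d hn) (Function.update (fun _ => ⟨0, by omega⟩) (lastIdx n hn)
    ⟨1, by omega⟩) (row_eq_zero_of_mem_adjoin ?_), fun σ hσ _ => ?_, fun σ hσ _ => ?_⟩
  · rintro _ ⟨σ, rfl⟩ g hg
    exact pt_V_update_const_off_diag hab σ g hg
  · exact pt_V_update_const_of_ne hab hσ _
  · exact V_update_const_self _ _ hσ
end

section
/- If d > n−2, then Q is positive definite (in particular Q is invertible). -/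
open Matrix ComplexOrder in
/-- Expanding the square of the norm of `u + V v` for a matrix `V` with orthonormal columns. -/
theorem re_dotProduct_add_unitary_nonneg {κ : Type*} [Fintype κ] [DecidableEq κ]
    (V : Matrix κ κ ℂ) (hV : Vᴴ * V = 1) (u v : κ → ℂ) :
    0 ≤ (star u ⬝ᵥ u).re + (star v ⬝ᵥ v).re + (star u ⬝ᵥ V *ᵥ v).re
      + (star v ⬝ᵥ Vᴴ *ᵥ u).re := by
  have h : star (u + V *ᵥ v) ⬝ᵥ (u + V *ᵥ v)
      = star u ⬝ᵥ u + star v ⬝ᵥ v + star u ⬝ᵥ V *ᵥ v + star v ⬝ᵥ Vᴴ *ᵥ u := by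
    rw [star_add, star_mulVec, add_dotProduct, dotProduct_add, dotProduct_add,
      ← dotProduct_mulVec, ← dotProduct_mulVec, mulVec_mulVec, hV, one_mulVec]
    ring
  rw [← Complex.add_re, ← Complex.add_re, ← Complex.add_re, ← h]
  exact (Complex.le_def.mp (dotProduct_star_self_nonneg (u + V *ᵥ v))).1

open Matrix ComplexOrder in
/-- Block diagonal dominance: a Hermitian block matrix with unitary off-diagonal blocks and
diagonal blocks `d • 1` is positive definite once `d` is at least the number of block rows. -/
theorem posDef_of_unitary_blocks {ι κ : Type*} [Fintype ι] [DecidableEq ι] [Fintype κ]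
    [DecidableEq κ] (U : ι → ι → Matrix κ κ ℂ) (hone : ∀ a, U a a = 1)
    (hstar : ∀ a b, (U a b)ᴴ = U b a) (hunit : ∀ a b, (U a b)ᴴ * U a b = 1)
    (d : ℕ) (hd : Fintype.card ι ≤ d) :
    (Matrix.of fun p q : ι × κ =>
      (d : ℂ) ^ (if p.1 = q.1 then 1 else 0 : ℕ) * U p.1 q.1 p.2 q.2).PosDef := by
  set M : Matrix (ι × κ) (ι × κ) ℂ := Matrix.of fun p q : ι × κ =>
      (d : ℂ) ^ (if p.1 = q.1 then 1 else 0 : ℕ) * U p.1 q.1 p.2 q.2 with hM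
  have hherm : M.IsHermitian := by
    ext p q
    have h := congrFun₂ (hstar q.1 p.1) p.2 q.2
    rw [conjTranspose_apply] at h
    simp only [hM, conjTranspose_apply, of_apply, ← h, star_mul', star_pow, star_natCast,
      eq_comm (a := q.1)]
  refine PosDef.of_dotProduct_mulVec_pos hherm fun x hx => ?_
  let y : ι → κ → ℂ := fun a i => x (a, i)
  let N : ι → ℝ := fun a => (star (y a) ⬝ᵥ y a).re
  let S : ι → ι → ℝ := fun a b => (star (y a) ⬝ᵥ U a b *ᵥ y b).re
  have hSdiag (a : ι) : S a a = N a := by simp [S, N, hone]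
  have hT (a b : ι) : 0 ≤ N a + N b + S a b + S b a := by
    have h := re_dotProduct_add_unitary_nonneg (U a b) (hunit a b) (y a) (y b)
    rwa [hstar] at h
  have hform : (star x ⬝ᵥ M *ᵥ x).re = ∑ a, ∑ b, S a b + (d - 1) * ∑ a, N a := by
    have hblock : star x ⬝ᵥ M *ᵥ x = ∑ a, ∑ b,
        (d : ℂ) ^ (if a = b then 1 else 0 : ℕ) * (star (y a) ⬝ᵥ U a b *ᵥ y b) := by
      simp only [dotProduct, mulVec, Fintype.sum_prod_type, hM, of_apply, Finset.mul_sum, y,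
        Pi.star_apply]
      refine Finset.sum_congr rfl fun a _ => ?_
      rw [Finset.sum_comm]
      refine Finset.sum_congr rfl fun b _ => Finset.sum_congr rfl fun i _ =>
        Finset.sum_congr rfl fun j _ => ?_
      ring
    rw [hblock, Complex.re_sum, Finset.mul_sum, ← Finset.sum_add_distrib]
    refine Finset.sum_congr rfl fun a _ => ?_
    have hterm (b : ι) : ((d : ℂ) ^ (if a = b then 1 else 0 : ℕ) *
        (star (y a) ⬝ᵥ U a b *ᵥ y b)).re = S a b + if a = b then (d - 1) * N a else 0 := by
      split_ifs with hab
      · subst hab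
        rw [← hSdiag, pow_one, ← Complex.ofReal_natCast, Complex.re_ofReal_mul]
        ring
      · simp [S]
    rw [Complex.re_sum, Finset.sum_congr rfl fun b _ => hterm b, Finset.sum_add_distrib]
    simp
  have hsum : 4 * ∑ a, N a ≤ 2 * Fintype.card ι * ∑ a, N a + 2 * ∑ a, ∑ b, S a b := by
    calc 4 * ∑ a, N a = ∑ a, (N a + N a + S a a + S a a) := by
          rw [Finset.mul_sum]
          exact Finset.sum_congr rfl fun a _ => by rw [hSdiag]; ring
      _ ≤ ∑ a, ∑ b, (N a + N b + S a b + S b a) :=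
          Finset.sum_le_sum fun a _ =>
            Finset.single_le_sum (f := fun b => N a + N b + S a b + S b a)
              (fun b _ => hT a b) (Finset.mem_univ a)
      _ = _ := by
          simp only [Finset.sum_add_distrib, Finset.sum_const, Finset.card_univ, nsmul_eq_mul,
            ← Finset.mul_sum]
          rw [Finset.sum_comm (f := fun a b => S b a)]
          ring
  have hN : 0 < ∑ a, N a := by
    have h := (Complex.lt_def.mp (dotProduct_star_self_pos_iff.mpr hx)).1
    simpa [N, y, dotProduct, Fintype.sum_prod_type] using h
  have hdR : (Fintype.card ι : ℝ) ≤ d := by exact_mod_cast hd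
  refine Complex.lt_def.mpr ⟨?_, (hherm.im_star_dotProduct_mulVec_self x).symm⟩
  rw [hform, Complex.zero_re]
  nlinarith [mul_le_mul_of_nonneg_right hdR hN.le]

/-- The permutation `(a l)(a b)(b l)` fixes `l`. -/
theorem swap_mul_swap_mul_swap_apply_self {α : Type*} [DecidableEq α] (a b l : α) :
    (Equiv.swap a l * Equiv.swap a b * Equiv.swap b l) l = l := by
  simp


/-- The block matrix `Q` with blocks indexed by `a, b ∈ {1,…,m}` and entries
`Q^{ab}_{ij} = d^{δ_{ab}} · φ_{ij}((a m)(a b)(b m))`, where `m` stands for the last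
position `ln` and a transposition `(x y)` with `x = y` is the identity. -/
noncomputable def Qmat (m d w : ℕ) (ln : Fin m)
    (φ : Equiv.Perm (Fin m) → Matrix (Fin w) (Fin w) ℂ) :
    Matrix (Fin m × Fin w) (Fin m × Fin w) ℂ :=
  Matrix.of fun p q =>
    ((d : ℂ) ^ (if p.1 = q.1 then 1 else 0 : ℕ)) *
      φ (Equiv.swap p.1 ln * Equiv.swap p.1 q.1 * Equiv.swap q.1 ln) p.2 q.2

open Matrix ComplexOrder in
/-- For an irreducible unitary matrix representation `φ` of `S(n−2)` (viewed as the
subgroup of `S(n−1)` fixing the last point `n−1`), if `d > n − 2` then the matrix `Q`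
is positive definite; in particular it is invertible. -/
theorem Q_posDef_of_gt (n d w : ℕ) (hn : 3 ≤ n) (hd : 1 ≤ d) (hw : 1 ≤ w)
    (ln : Fin (n - 1)) (hln : (ln : ℕ) = n - 2)
    (φ : Equiv.Perm (Fin (n - 1)) → Matrix (Fin w) (Fin w) ℂ)
    (hid : φ 1 = 1)
    (hmul : ∀ σ τ : Equiv.Perm (Fin (n - 1)),
      σ ln = ln → τ ln = ln → φ (σ * τ) = φ σ * φ τ)
    (hunitary : ∀ σ : Equiv.Perm (Fin (n - 1)), σ ln = ln → (φ σ)ᴴ * φ σ = 1)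
    (hirred : ∀ M : Matrix (Fin w) (Fin w) ℂ,
      (∀ σ : Equiv.Perm (Fin (n - 1)), σ ln = ln → M * φ σ = φ σ * M) →
      ∃ c : ℂ, M = c • (1 : Matrix (Fin w) (Fin w) ℂ))
    (hgt : n - 2 < d) :
    (Qmat (n - 1) d w ln φ).PosDef := by
  have hfix (a b : Fin (n - 1)) := swap_mul_swap_mul_swap_apply_self a b ln
  have hinv (a b : Fin (n - 1)) :
      (Equiv.swap b ln * Equiv.swap b a * Equiv.swap a ln) *
        (Equiv.swap a ln * Equiv.swap a b * Equiv.swap b ln) = 1 := by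
    rw [Equiv.swap_comm b a]
    simp [mul_assoc]
  refine posDef_of_unitary_blocks
    (fun a b => φ (Equiv.swap a ln * Equiv.swap a b * Equiv.swap b ln)) (fun a => ?_)
    (fun a b => ?_) (fun a b => hunitary _ (hfix a b)) d ?_
  · rw [Equiv.swap_self, ← Equiv.Perm.one_def, mul_one, Equiv.swap_mul_self, hid]
  · refine left_inv_eq_right_inv (hunitary _ (hfix a b)) ?_
    rw [← hmul _ _ (hfix a b) (hfix b a), hinv, hid]
  · rw [Fintype.card_fin]
    omega
end

section
/- Assume the matrix A is invertible and that x_{pq} ≠ 0 for some indices p,q. Then: (i) x_{ij} ≠ 0 for all i,j; (ii) the m² elements (x_{ij}) are linearly independent over ℂ; (iii) the elements y_{kj} := Σ_{i} (A⁻¹)_{ik} x_{ij} satisfy the matrix-unit relations y_{ij} · y_{kl} = δ_{jk} y_{il}, so the ℂ-linear span of the x_{ij} is isomorphic as a ℂ-algebra to the full matrix algebra M(m,ℂ); (iv) the element 1' := Σ_{i,j} (A⁻¹)_{ij} x_{ij} is a two-sided unit of the span: 1'·x_{kl} = x_{kl} = x_{kl}·1' for all k,l. -/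
section MatrixCombination

variable {K B n : Type*} [Field K] [NonUnitalRing B] [Module K B] [Fintype n]

/-- The linear map sending a matrix `U` to the combination `∑ i, ∑ j, U i j • x i j`. -/
def matrixCombination (x : n → n → B) : Matrix n n K →ₗ[K] B where
  toFun U := ∑ i, ∑ j, U i j • x i j
  map_add' U V := by simp [add_smul, Finset.sum_add_distrib]
  map_smul' c U := by simp [mul_smul, Finset.smul_sum]

theorem matrixCombination_apply (x : n → n → B) (U : Matrix n n K) :
    matrixCombination x U = ∑ i, ∑ j, U i j • x i j := rfl

theorem matrixCombination_mul_single [DecidableEq n] (x : n → n → B) (U : Matrix n n K)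
    (k l : n) :
    matrixCombination x (U * Matrix.single k l 1) = ∑ i, U i k • x i l := by
  refine Finset.sum_congr rfl fun i _ => ?_
  rw [Finset.sum_eq_single l]
  · simp
  · intro j _ hj
    simp [hj]
  · simp

theorem matrixCombination_single [DecidableEq n] (x : n → n → B) (k l : n) :
    matrixCombination x (Matrix.single k l (1 : K)) = x k l := by
  rw [← one_mul (Matrix.single k l (1 : K)), matrixCombination_mul_single]
  simp [Matrix.one_apply]

theorem range_matrixCombination [DecidableEq n] (x : n → n → B) :
    LinearMap.range (matrixCombination (K := K) x) =
      Submodule.span K (Set.range fun ij : n × n => x ij.1 ij.2) := by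
  apply le_antisymm
  · rintro _ ⟨U, rfl⟩
    exact Submodule.sum_mem _ fun i _ => Submodule.sum_mem _ fun j _ =>
      Submodule.smul_mem _ _ (Submodule.subset_span ⟨(i, j), rfl⟩)
  · rw [Submodule.span_le]
    rintro _ ⟨ij, rfl⟩
    exact ⟨_, matrixCombination_single x ij.1 ij.2⟩

variable [SMulCommClass K B B] [IsScalarTower K B B] {x : n → n → B} {A : Matrix n n K}

theorem matrixCombination_mul_matrixCombination
    (hx : ∀ i j k l, x i j * x k l = A j k • x i l) (U V : Matrix n n K) :
    matrixCombination x U * matrixCombination x V = matrixCombination x (U * A * V) := by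
  simp only [matrixCombination_apply, Finset.sum_mul]
  simp only [Finset.mul_sum, smul_mul_smul_comm, hx, smul_smul, Matrix.mul_apply, Finset.sum_smul]
  refine Finset.sum_congr rfl fun i _ => ?_
  calc
    _ = ∑ k, ∑ j, ∑ l, (U i j * V k l * A j k) • x i l := Finset.sum_comm
    _ = ∑ k, ∑ l, ∑ j, (U i j * V k l * A j k) • x i l :=
      Finset.sum_congr rfl fun k _ => Finset.sum_comm
    _ = ∑ l, ∑ k, ∑ j, (U i j * V k l * A j k) • x i l := Finset.sum_comm
    _ = _ := by simp only [mul_right_comm, Finset.sum_mul, Finset.sum_smul]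

theorem matrixCombination_injective [DecidableEq n]
    (hx : ∀ i j k l, x i j * x k l = A j k • x i l) (hA : IsUnit A.det)
    {p q : n} (hpq : x p q ≠ 0) :
    Function.Injective (matrixCombination (K := K) x) := by
  rw [injective_iff_map_eq_zero]
  intro U hU
  have hAUA : A * U * A = 0 := by
    ext j k
    have h : matrixCombination x
        (Matrix.single p j 1 * A * U * A * Matrix.single k q (1 : K)) = 0 := by
      rw [← matrixCombination_mul_matrixCombination hx,
        ← matrixCombination_mul_matrixCombination hx, hU, mul_zero, zero_mul]
    have hs : Matrix.single p j 1 * A * U * A * Matrix.single k q (1 : K) =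
        (A * U * A) j k • Matrix.single p q 1 := by
      rw [Matrix.mul_assoc (Matrix.single p j 1), Matrix.mul_assoc (Matrix.single p j 1),
        Matrix.single_mul_mul_single]
      simp
    rw [hs, map_smul, matrixCombination_single] at h
    exact (smul_eq_zero.mp h).resolve_right hpq
  have hUA := congrArg (fun M => A⁻¹ * M * A⁻¹) hAUA
  simpa [Matrix.mul_assoc, Matrix.mul_nonsing_inv _ hA,
    Matrix.nonsing_inv_mul_cancel_left _ _ hA] using hUA

end MatrixCombination


/-- Properties of the algebra `X_A` spanned by elements `x_{ij}` of a (possibly non-unital)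
associative `ℂ`-algebra `B` with multiplication rule `x_{ij} x_{kl} = a_{jk} x_{il}`,
when `A` is invertible and some `x_{pq} ≠ 0`:
(i) all `x_{ij} ≠ 0`; (ii) the `x_{ij}` are linearly independent;
(iii) the elements `y_{kj} = Σ_i (A⁻¹)_{ik} x_{ij}` satisfy the matrix-unit relations,
so the span of the `x_{ij}` is isomorphic as a `ℂ`-algebra to `M(m,ℂ)`;
(iv) `1' = Σ_{ij} (A⁻¹)_{ij} x_{ij}` is a two-sided unit of the span. -/
theorem XA_matrix_algebra (B : Type*) [NonUnitalRing B] [Module ℂ B]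
    [SMulCommClass ℂ B B] [IsScalarTower ℂ B B]
    (m : ℕ) (hm : 1 ≤ m) (A : Matrix (Fin m) (Fin m) ℂ)
    (x : Fin m → Fin m → B)
    (hx : ∀ i j k l : Fin m, x i j * x k l = A j k • x i l)
    (hA : IsUnit A.det)
    (p q : Fin m) (hpq : x p q ≠ 0) :
    (∀ i j : Fin m, x i j ≠ 0) ∧
    LinearIndependent ℂ (fun ij : Fin m × Fin m => x ij.1 ij.2) ∧
    (∀ i j k l : Fin m,
      (∑ r : Fin m, (A⁻¹ r i) • x r j) * (∑ r : Fin m, (A⁻¹ r k) • x r l) =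
        if j = k then (∑ r : Fin m, (A⁻¹ r i) • x r l) else 0) ∧
    (∃ f : Matrix (Fin m) (Fin m) ℂ →ₗ[ℂ] B,
      Function.Injective f ∧
      LinearMap.range f =
        Submodule.span ℂ (Set.range fun ij : Fin m × Fin m => x ij.1 ij.2) ∧
      ∀ U W : Matrix (Fin m) (Fin m) ℂ, f (U * W) = f U * f W) ∧
    (∀ k l : Fin m,
      (∑ i : Fin m, ∑ j : Fin m, (A⁻¹ i j) • x i j) * x k l = x k l ∧
      x k l * (∑ i : Fin m, ∑ j : Fin m, (A⁻¹ i j) • x i j) = x k l) := by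
  have hinj := matrixCombination_injective hx hA hpq
  have hmul := matrixCombination_mul_matrixCombination hx
  have hinv : ∀ U W, A⁻¹ * U * A * (A⁻¹ * W) = A⁻¹ * (U * W) := fun U W => by
    rw [Matrix.mul_assoc, Matrix.mul_nonsing_inv_cancel_left _ _ hA, Matrix.mul_assoc]
  refine ⟨fun i j => ?_, ?_, fun i j k l => ?_, ?_, fun k l => ?_⟩
  · rw [← matrixCombination_single (K := ℂ) x i j, map_ne_zero_iff _ hinj]
    intro h
    simpa using congrFun (congrFun h i) j
  · rw [Fintype.linearIndependent_iff]
    intro g hg ij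
    have h : (Matrix.of fun i j => g (i, j)) = 0 :=
      hinj (by simpa [matrixCombination_apply, Fintype.sum_prod_type] using hg)
    exact congrFun (congrFun h ij.1) ij.2
  · simp only [← matrixCombination_mul_single]
    rw [hmul, hinv]
    split_ifs with hjk
    · subst hjk
      simp
    · simp [hjk]
  · refine ⟨matrixCombination x ∘ₗ LinearMap.mulLeft ℂ A⁻¹, ?_, ?_, fun U W => ?_⟩
    · refine hinj.comp fun U W hUW => ?_
      have h := congrArg (A * ·) hUW
      simpa [Matrix.mul_nonsing_inv_cancel_left _ _ hA] using h
    · rw [LinearMap.range_comp_of_range_eq_top, range_matrixCombination]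
      exact LinearMap.range_eq_top.mpr fun U =>
        ⟨A * U, Matrix.nonsing_inv_mul_cancel_left _ _ hA⟩
    · simp [hmul, hinv]
  · rw [← matrixCombination_apply, ← matrixCombination_single (K := ℂ) x k l, hmul, hmul,
      Matrix.nonsing_inv_mul _ hA, Matrix.one_mul, Matrix.mul_assoc, Matrix.mul_nonsing_inv _ hA,
      Matrix.mul_one]
    exact ⟨rfl, rfl⟩
end

section
/- Assume the m² elements (x_{ij}) are linearly independent over ℂ and det A = 0. Then there exists a nonzero element w in the ℂ-linear span of the x_{ij} such that x_{ij} · w = 0 for all i,j ∈ {1,…,m}; in particular the span contains a nonzero properly nilpotent element, so it is not a semisimple algebra. -/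
/-- If the `x_{ij}` (satisfying `x_{ij} x_{kl} = a_{jk} x_{il}` in a possibly non-unital
associative `ℂ`-algebra `B`) are linearly independent and `det A = 0`, then the span of
the `x_{ij}` contains a nonzero element `w` with `x_{ij} · w = 0` for all `i, j`
(a nonzero properly nilpotent element, so the span is not semisimple). -/
theorem XA_not_semisimple (B : Type*) [NonUnitalRing B] [Module ℂ B]
    [SMulCommClass ℂ B B] [IsScalarTower ℂ B B]
    (m : ℕ) (hm : 1 ≤ m) (A : Matrix (Fin m) (Fin m) ℂ)
    (x : Fin m → Fin m → B)
    (hx : ∀ i j k l : Fin m, x i j * x k l = A j k • x i l)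
    (hlin : LinearIndependent ℂ (fun ij : Fin m × Fin m => x ij.1 ij.2))
    (hdet : A.det = 0) :
    ∃ w ∈ Submodule.span ℂ (Set.range fun ij : Fin m × Fin m => x ij.1 ij.2),
      w ≠ 0 ∧ ∀ i j : Fin m, x i j * w = 0 := by
  obtain ⟨v, hv, hAv⟩ := Matrix.exists_mulVec_eq_zero_iff.mpr hdet
  let l₀ : Fin m := ⟨0, hm⟩
  refine ⟨∑ k, v k • x k l₀, ?_, ?_, ?_⟩
  · exact Submodule.sum_mem _ fun k _ =>
      Submodule.smul_mem _ _ (Submodule.subset_span ⟨(k, l₀), rfl⟩)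
  · intro h
    have hcol : LinearIndependent ℂ fun k => x k l₀ :=
      hlin.comp (fun k => (k, l₀)) fun _ _ h => congrArg Prod.fst h
    exact hv (funext (Fintype.linearIndependent_iff.mp hcol v h))
  · intro i j
    have hj : ∑ k, A j k * v k = 0 := congrFun hAv j
    calc x i j * ∑ k, v k • x k l₀ = (∑ k, A j k * v k) • x i l₀ := by
          simp only [Finset.mul_sum, mul_smul_comm, hx, smul_smul, Finset.sum_smul, mul_comm]
      _ = 0 := by rw [hj, zero_smul]
end

section
/- Suppose Z ∈ M(m,ℂ) is invertible and λ_1,…,λ_m ∈ ℂ satisfy Z⁻¹AZ = diag(λ_1,…,λ_m). Define y_{sr} := Σ_{i,j} (Z⁻¹)_{rj} Z_{is} x_{ij}. Then y_{sr} · y_{uv} = λ_r δ_{ru} y_{sv} for all s,r,u,v ∈ {1,…,m}. Moreover, if μ_1,…,μ_m ∈ ℂ are chosen with μ_r² = λ_r for each r, then the rescaled elements f_{sr} := (μ_s μ_r)⁻¹ y_{sr}, defined for indices s,r with λ_s ≠ 0 and λ_r ≠ 0, satisfy the matrix-unit relations f_{sr} · f_{uv} = δ_{ru} f_{sv}. 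-/
/-- If `x i j * x k l = A j k • x i l`, then products of combinations of the `x i j` with
rank-one coefficients contract the inner coefficient vectors through `A`. -/
theorem sum_rankOne_smul_mul {R B ι : Type*} [CommSemiring R] [NonUnitalSemiring B] [Module R B]
    [SMulCommClass R B B] [IsScalarTower R B B] [Fintype ι] {A : Matrix ι ι R}
    {x : ι → ι → B} (hx : ∀ i j k l, x i j * x k l = A j k • x i l) (a b c d : ι → R) :
    (∑ i, ∑ j, (a j * b i) • x i j) * (∑ i, ∑ j, (c j * d i) • x i j) =
      (∑ j, ∑ k, a j * A j k * d k) • ∑ i, ∑ j, (c j * b i) • x i j := by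
  simp only [Finset.sum_mul_sum, smul_mul_smul_comm, hx, Finset.smul_sum, Finset.sum_smul]
  simp only [smul_smul]
  refine Finset.sum_congr rfl fun i _ => ?_
  rw [Finset.sum_comm]
  conv_rhs => rw [Finset.sum_comm]
  refine Finset.sum_congr rfl fun j _ => ?_
  rw [Finset.sum_comm]
  refine Finset.sum_congr rfl fun l _ => Finset.sum_congr rfl fun k _ => ?_
  congr 1
  ring

/-- Reduced basis of the algebra `X_A`. If `Z⁻¹ A Z = diag(λ_1,…,λ_m)`, then the elements
`y_{sr} = Σ_{ij} (Z⁻¹)_{rj} Z_{is} x_{ij}` satisfy `y_{sr} y_{uv} = λ_r δ_{ru} y_{sv}`;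
and if `μ_r² = λ_r`, the rescaled elements `f_{sr} = (μ_s μ_r)⁻¹ y_{sr}` (for indices with
nonzero eigenvalue) satisfy the matrix-unit relations `f_{sr} f_{uv} = δ_{ru} f_{sv}`. -/
theorem XA_reduced_basis (B : Type*) [NonUnitalRing B] [Module ℂ B]
    [SMulCommClass ℂ B B] [IsScalarTower ℂ B B]
    (m : ℕ) (hm : 1 ≤ m) (A : Matrix (Fin m) (Fin m) ℂ)
    (x : Fin m → Fin m → B)
    (hx : ∀ i j k l : Fin m, x i j * x k l = A j k • x i l)
    (Z : Matrix (Fin m) (Fin m) ℂ) (hZ : IsUnit Z.det)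
    (lam : Fin m → ℂ) (hdiag : Z⁻¹ * A * Z = Matrix.diagonal lam) :
    (∀ s r u v : Fin m,
      (∑ i : Fin m, ∑ j : Fin m, (Z⁻¹ r j * Z i s) • x i j) *
        (∑ i : Fin m, ∑ j : Fin m, (Z⁻¹ v j * Z i u) • x i j) =
      if r = u then
        lam r • (∑ i : Fin m, ∑ j : Fin m, (Z⁻¹ v j * Z i s) • x i j)
      else 0) ∧
    (∀ μ : Fin m → ℂ, (∀ r, μ r ^ 2 = lam r) →
      ∀ s r u v : Fin m, lam s ≠ 0 → lam r ≠ 0 → lam u ≠ 0 → lam v ≠ 0 →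
        ((μ s * μ r)⁻¹ • ∑ i : Fin m, ∑ j : Fin m, (Z⁻¹ r j * Z i s) • x i j) *
          ((μ u * μ v)⁻¹ • ∑ i : Fin m, ∑ j : Fin m, (Z⁻¹ v j * Z i u) • x i j) =
        if r = u then
          (μ s * μ v)⁻¹ • ∑ i : Fin m, ∑ j : Fin m, (Z⁻¹ v j * Z i s) • x i j
        else 0) := by
  have hcoef (r u : Fin m) :
      ∑ j, ∑ k, Z⁻¹ r j * A j k * Z k u = if r = u then lam r else 0 := by
    rw [← Matrix.diagonal_apply, ← hdiag, Finset.sum_comm]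
    simp only [Matrix.mul_apply, Finset.sum_mul]
  have hmul (s r u v : Fin m) :
      (∑ i : Fin m, ∑ j : Fin m, (Z⁻¹ r j * Z i s) • x i j) *
        (∑ i : Fin m, ∑ j : Fin m, (Z⁻¹ v j * Z i u) • x i j) =
      if r = u then
        lam r • (∑ i : Fin m, ∑ j : Fin m, (Z⁻¹ v j * Z i s) • x i j)
      else 0 := by
    rw [sum_rankOne_smul_mul hx (Z⁻¹ r) (fun i => Z i s) (Z⁻¹ v) (fun i => Z i u), hcoef,
      ite_smul, zero_smul]
  refine ⟨hmul, fun μ hμ s r u v hs hr hu hv => ?_⟩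
  have hμ0 {t : Fin m} (ht : lam t ≠ 0) : μ t ≠ 0 := fun h => ht (by simp [← hμ, h])
  rw [smul_mul_smul_comm, hmul]
  split_ifs with h
  · subst h
    rw [smul_smul, ← hμ r]
    congr 1
    have := hμ0 hs
    have := hμ0 hr
    have := hμ0 hv
    field_simp
  · exact smul_zero _
end
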